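/- Let R be an associative algebra over a commutative ring k, let A : ι → R and B : κ → R be families indexed by finite types, and let H ⊆ R be a k-subalgebra (closed under addition, scalar multiplication, and products) such that: (i) [B_β, h] ∈ H for all h ∈ H and β ∈ κ; (ii) for all α ∈ ι, β ∈ κ there exist elements h(α,β,γ) ∈ H with [A_α, B_β] = Σ_{γ ∈ ι} h(α,β,γ) A_γ. Then for every α ∈ ι and every word w of length m ≥ 1 in the family B, the commutator [A_α, w] lies in the additive span of the elements h · A_γ · w′, where h ∈ H, γ ∈ ι, and w′ ranges over the words in B of length at most m − 1. -/

import Mathlib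

/-- The additive span of the elements `h · A_γ · w` with `h ∈ H` and `w` a word in `B` of length
less than `n`. -/
def wordSpan {k R ι κ : Type*} [CommRing k] [Ring R] [Algebra k R]
    (A : ι → R) (B : κ → R) (H : Subalgebra k R) (n : ℕ) : AddSubgroup R :=
  AddSubgroup.closure
    {x : R | ∃ h ∈ H, ∃ γ : ι, ∃ l : List κ, l.length < n ∧ x = h * (A γ * (l.map B).prod)}

section wordSpan

variable {k R ι κ : Type*} [CommRing k] [Ring R] [Algebra k R]
  {A : ι → R} {B : κ → R} {H : Subalgebra k R}

theorem mul_mem_wordSpan {n : ℕ} {h : R} (hh : h ∈ H) (γ : ι) {l : List κ} (hl : l.length < n) :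
    h * (A γ * (l.map B).prod) ∈ wordSpan A B H n :=
  AddSubgroup.subset_closure ⟨h, hh, γ, l, hl, rfl⟩

theorem mul_commutator_mul_mem_wordSpan [Fintype ι]
    (hcomm : ∀ α : ι, ∀ β : κ, ∃ Γ : ι → R, (∀ γ : ι, Γ γ ∈ H) ∧
      A α * B β - B β * A α = ∑ γ : ι, Γ γ * A γ)
    {n : ℕ} {h : R} (hh : h ∈ H) (α : ι) (β : κ) {l : List κ} (hl : l.length < n) :
    h * ((A α * B β - B β * A α) * (l.map B).prod) ∈ wordSpan A B H n := by
  obtain ⟨Γ, hΓ, hcomm_eq⟩ := hcomm α β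
  rw [hcomm_eq, Finset.sum_mul, Finset.mul_sum]
  refine sum_mem fun γ _ => ?_
  rw [mul_assoc, ← mul_assoc]
  exact mul_mem_wordSpan (H.mul_mem hh (hΓ γ)) γ hl

theorem left_mul_mem_wordSpan_succ [Fintype ι]
    (hstable : ∀ h ∈ H, ∀ β : κ, B β * h - h * B β ∈ H)
    (hcomm : ∀ α : ι, ∀ β : κ, ∃ Γ : ι → R, (∀ γ : ι, Γ γ ∈ H) ∧
      A α * B β - B β * A α = ∑ γ : ι, Γ γ * A γ)
    {n : ℕ} (β : κ) {x : R} (hx : x ∈ wordSpan A B H n) :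
    B β * x ∈ wordSpan A B H (n + 1) := by
  induction hx using AddSubgroup.closure_induction with
  | mem x hx =>
    obtain ⟨h, hh, γ, l, hl, rfl⟩ := hx
    have hmove : B β * (h * (A γ * (l.map B).prod)) =
        (B β * h - h * B β) * (A γ * (l.map B).prod)
          + h * (A γ * ((β :: l).map B).prod)
          - h * ((A γ * B β - B β * A γ) * (l.map B).prod) := by
      rw [List.map_cons, List.prod_cons]
      noncomm_ring
    rw [hmove]
    have hl' : l.length < n + 1 := hl.trans n.lt_succ_self
    exact sub_mem
      (add_mem (mul_mem_wordSpan (hstable h hh β) γ hl')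
        (mul_mem_wordSpan hh γ (Nat.succ_lt_succ hl)))
      (mul_commutator_mul_mem_wordSpan hcomm hh γ β hl')
  | zero => simp [zero_mem]
  | add x y _ _ hx hy => rw [mul_add]; exact add_mem hx hy
  | neg x _ hx => rw [mul_neg]; exact neg_mem hx

theorem commutator_word_mem_wordSpan [Fintype ι]
    (hstable : ∀ h ∈ H, ∀ β : κ, B β * h - h * B β ∈ H)
    (hcomm : ∀ α : ι, ∀ β : κ, ∃ Γ : ι → R, (∀ γ : ι, Γ γ ∈ H) ∧
      A α * B β - B β * A α = ∑ γ : ι, Γ γ * A γ)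
    (α : ι) (l : List κ) :
    A α * (l.map B).prod - (l.map B).prod * A α ∈ wordSpan A B H l.length := by
  induction l with
  | nil => simp [zero_mem]
  | cons β l ih =>
    have hleibniz : A α * ((β :: l).map B).prod - ((β :: l).map B).prod * A α =
        1 * ((A α * B β - B β * A α) * (l.map B).prod)
          + B β * (A α * (l.map B).prod - (l.map B).prod * A α) := by
      rw [List.map_cons, List.prod_cons]
      noncomm_ring
    rw [hleibniz, List.length_cons]
    exact add_mem (mul_commutator_mul_mem_wordSpan hcomm H.one_mem α β l.length.lt_succ_self)
      (left_mul_mem_wordSpan_succ hstable hcomm β ih)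

end wordSpan

/-- Commutator of one element of the family `A` with a word in the family `B`,
with coefficients in a subalgebra `H` stable under commutation with `B`.
If `[B_β, h] ∈ H` for `h ∈ H` and `[A_α, B_β] = Σ_γ h(α,β,γ) A_γ` with
`h(α,β,γ) ∈ H`, then for every word `w` of length `m ≥ 1` in `B`, the
commutator `[A_α, w]` lies in the additive span of the elements
`h · A_γ · w′` with `h ∈ H` and `w′` a word in `B` of length at most `m − 1`. -/
theorem stmt13 {k R ι κ : Type*} [CommRing k] [Ring R] [Algebra k R]
    [Fintype ι] [Fintype κ] (A : ι → R) (B : κ → R) (H : Subalgebra k R)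
    (hstable : ∀ h ∈ H, ∀ β : κ, B β * h - h * B β ∈ H)
    (hcomm : ∀ α : ι, ∀ β : κ, ∃ Γ : ι → R, (∀ γ : ι, Γ γ ∈ H) ∧
      A α * B β - B β * A α = ∑ γ : ι, Γ γ * A γ) :
    ∀ α : ι, ∀ l : List κ, 1 ≤ l.length →
      A α * (l.map B).prod - (l.map B).prod * A α ∈
        AddSubgroup.closure
          {x : R | ∃ h ∈ H, ∃ γ : ι, ∃ l' : List κ, l'.length < l.length ∧
            x = h * (A γ * (l'.map B).prod)} := by
  intro α l _
  exact commutator_word_mem_wordSpan hstable hcomm α l
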